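/- Let M be a finite-dimensional A-module and let U ⊆ V be an r-dimensional subspace. Then α_U^*(M) is free as a C-module if and only if for every nonzero u ∈ U, M is free as a k[t]/(tᵖ)-module with t acting by multiplication by u. -/

import Mathlib

open scoped TensorProduct

set_option synthInstance.maxHeartbeats 1000000
set_option maxHeartbeats 1000000

noncomputable section

def truncIdeal (k : Type*) [Field k] (n p : ℕ) : Ideal (MvPolynomial (Fin n) k) :=
  Ideal.span (Set.range fun i : Fin n => (MvPolynomial.X i : MvPolynomial (Fin n) k) ^ p)

abbrev TruncAlg (k : Type*) [Field k] (n p : ℕ) :=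
  MvPolynomial (Fin n) k ⧸ truncIdeal k n p

def xGen (k : Type*) [Field k] (n p : ℕ) (i : Fin n) : TruncAlg k n p :=
  Ideal.Quotient.mk (truncIdeal k n p) (MvPolynomial.X i)

def radIdeal (k : Type*) [Field k] (n p : ℕ) : Ideal (TruncAlg k n p) :=
  Ideal.span (Set.range (xGen k n p))

def xSpan (k : Type*) [Field k] (n p : ℕ) : Submodule k (TruncAlg k n p) :=
  Submodule.span k (Set.range (xGen k n p))

def IsFreeVia {C A : Type*} [CommRing C] [CommRing A] (α : C →+* A)
    (M : Type*) [AddCommGroup M] [Module A M] : Prop :=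
  letI : Module C M := Module.compHom M α
  Module.Free C M

def smulLinear (k : Type*) {A : Type*} (M : Type*) [CommSemiring k] [Semiring A]
    [AddCommMonoid M] [Module k M] [Module A M] [SMulCommClass k A M] (a : A) :
    M →ₗ[k] M where
  toFun m := a • m
  map_add' x y := smul_add a x y
  map_smul' c m := (smul_comm c a m).symm

def radPow (k A M : Type*) [CommSemiring k] [CommRing A] [AddCommMonoid M]
    [Module k M] [Module A M] [SMulCommClass k A M] (U : Set A) (j : ℕ) :
    Submodule k M :=
  ⨆ (u : Fin j → A) (_ : ∀ i, u i ∈ U), LinearMap.range (smulLinear k M (∏ i, u i))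

def socPow (k A M : Type*) [CommSemiring k] [CommRing A] [AddCommMonoid M]
    [Module k M] [Module A M] [SMulCommClass k A M] (U : Set A) (j : ℕ) :
    Submodule k M :=
  ⨅ (u : Fin j → A) (_ : ∀ i, u i ∈ U), LinearMap.ker (smulLinear k M (∏ i, u i))

theorem sub_pow_pred_char_eq_geom_sum (k : Type*) {A : Type*} [Field k] [CommRing A] [Algebra k A]
    (p : ℕ) [Fact p.Prime] [CharP k p] (x y : A) :
    (y - x) ^ (p - 1) = ∑ i ∈ Finset.range p, y ^ i * x ^ (p - 1 - i) := by
  have hp : p - 1 + 1 = p := Nat.sub_add_cancel (Fact.out : p.Prime).one_le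
  have key : ((MvPolynomial.X 1 - MvPolynomial.X 0 : MvPolynomial (Fin 2) k)) ^ (p - 1) =
      ∑ i ∈ Finset.range p, MvPolynomial.X 1 ^ i * MvPolynomial.X 0 ^ (p - 1 - i) := by
    have h0 : (MvPolynomial.X 1 - MvPolynomial.X 0 : MvPolynomial (Fin 2) k) ≠ 0 :=
      sub_ne_zero.mpr fun h => by simpa using MvPolynomial.X_injective h
    apply mul_right_cancel₀ h0
    rw [geom_sum₂_mul, ← pow_succ, hp, sub_pow_char]
  have := congrArg (MvPolynomial.aeval (R := k) ![x, y]) key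
  simpa using this

theorem geom_sum_smul_sub_smul {k A M : Type*} [Field k] [CommRing A] [Algebra k A]
    [AddCommGroup M] [Module k M] [Module A M] [IsScalarTower k A M]
    (x y : A) (c : k) (v a : M) (h : y • v = x • a) (n : ℕ) :
    (∑ i ∈ Finset.range (n + 1), y ^ i * (c • x) ^ (n - i)) • (a - c • v) =
      y ^ n • a - c ^ (n + 1) • x ^ n • v := by
  induction n with
  | zero => simp
  | succ n ih =>
    have h1 : ∑ i ∈ Finset.range (n + 1 + 1), y ^ i * (c • x) ^ (n + 1 - i) =
        y * (∑ i ∈ Finset.range (n + 1), y ^ i * (c • x) ^ (n - i)) + (c • x) ^ (n + 1) := by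
      rw [Finset.sum_range_succ', Finset.mul_sum]
      simp [pow_succ', mul_assoc]
    have h2 : y • x ^ n • v = x ^ (n + 1) • a := by
      rw [smul_comm, h, smul_smul, ← pow_succ]
    rw [h1, add_smul, mul_smul, ih, smul_sub, smul_smul, ← pow_succ', smul_comm y (c ^ (n + 1)), h2,
      smul_pow, smul_sub, smul_assoc, smul_assoc, smul_comm (x ^ (n + 1)) c v,
      smul_smul (c ^ (n + 1)) c, ← pow_succ]
    abel

theorem exists_eigenvector_mod {k M : Type*} [Field k] [IsAlgClosed k] [AddCommGroup M]
    [Module k M] [FiniteDimensional k M] (f : Module.End k M) (K L : Submodule k M)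
    (hK : ∀ v ∈ K, f v ∈ K) (hL : ∀ v ∈ L, f v ∈ L) (hKL : ¬ K ≤ L) :
    ∃ v ∈ K, v ∉ L ∧ ∃ c : k, f v - c • v ∈ L := by
  let g : Module.End k (M ⧸ L) := L.mapQ L f hL
  have hg : ∀ w ∈ K.map L.mkQ, g w ∈ K.map L.mkQ := by
    rintro _ ⟨v, hv, rfl⟩
    exact ⟨f v, hK v hv, by simp [g]⟩
  have : Nontrivial (K.map L.mkQ) := by
    rw [Submodule.nontrivial_iff_ne_bot]
    intro h
    refine hKL fun v hv => ?_
    have hv' : L.mkQ v ∈ K.map L.mkQ := ⟨v, hv, rfl⟩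
    simpa [h] using hv'
  obtain ⟨c, hc⟩ := Module.End.exists_eigenvalue (g.restrict hg)
  obtain ⟨⟨w, v, hv, rfl⟩, hw⟩ := hc.exists_hasEigenvector
  refine ⟨v, hv, ?_, c, ?_⟩
  · intro hvL
    exact hw.2 (by ext; simpa using hvL)
  · have := congrArg Subtype.val hw.apply_eq_smul
    simp only [g, LinearMap.coe_restrict_apply, Submodule.mkQ_apply, Submodule.mapQ_apply,
      SetLike.val_smul] at this
    rwa [← Submodule.Quotient.mk_smul, Submodule.Quotient.eq] at this

theorem LinearMap.exists_pseudoinverse {k M : Type*} [Field k] [AddCommGroup M]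
    [Module k M] (f : Module.End k M) : ∃ g : Module.End k M, ∀ v, f (g (f v)) = f v := by
  obtain ⟨s, hs⟩ := f.rangeRestrict.exists_rightInverse_of_surjective f.range_rangeRestrict
  obtain ⟨t, ht⟩ := (LinearMap.range f).subtype.exists_leftInverse_of_injective (by simp)
  refine ⟨s ∘ₗ t, fun v => ?_⟩
  have h1 : t (f v) = f.rangeRestrict v := LinearMap.congr_fun ht (f.rangeRestrict v)
  have h2 := congrArg Subtype.val (LinearMap.congr_fun hs (f.rangeRestrict v))
  simpa [h1] using h2

theorem mem_range_pow_sup_of_smul_mem {k A M : Type*} [Field k] [IsAlgClosed k] [CommRing A]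
    [Algebra k A] [AddCommGroup M] [Module k M] [Module A M] [IsScalarTower k A M]
    [FiniteDimensional k M] (p : ℕ) [Fact p.Prime] [CharP k p] (x y : A)
    (hxp : x ^ p = 0) (hyp : y ^ p = 0)
    (hx₁ : ∀ m : M, x • m = 0 → ∃ d : M, m = x ^ (p - 1) • d)
    (hx₂ : ∀ m : M, x ^ (p - 1) • m = 0 → ∃ d : M, m = x • d)
    (hz₁ : ∀ (c : k) (m : M), (y - c • x) • m = 0 → ∃ d : M, m = (y - c • x) ^ (p - 1) • d)
    (hz₂ : ∀ (c : k) (m : M), (y - c • x) ^ (p - 1) • m = 0 → ∃ d : M, m = (y - c • x) • d)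
    (v a : M) (hva : y • v = x • a) : ∃ d e : M, v = y ^ (p - 1) • d + x • e := by
  have hp : p - 1 + 1 = p := Nat.sub_add_cancel (Fact.out : p.Prime).one_le
  have hxx : x * x ^ (p - 1) = 0 := by rw [← pow_succ', hp, hxp]
  have hyy : y * y ^ (p - 1) = 0 := by rw [← pow_succ', hp, hyp]
  let X : Module.End k M := Algebra.lsmul k k M x
  let Y : Module.End k M := Algebra.lsmul k k M y
  let X' : Module.End k M := Algebra.lsmul k k M (x ^ (p - 1))
  let Y' : Module.End k M := Algebra.lsmul k k M (y ^ (p - 1))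
  obtain ⟨S, hS⟩ := LinearMap.exists_pseudoinverse X
  obtain ⟨T, hT⟩ := LinearMap.exists_pseudoinverse X'
  let Q : Module.End k M := T ∘ₗ Y' ∘ₗ S ∘ₗ Y
  let K : Submodule k M := (LinearMap.range X).comap Y
  let L : Submodule k M := LinearMap.range Y' ⊔ LinearMap.range X
  have hXL : ∀ e : M, x • e ∈ L := fun e => Submodule.mem_sup_right ⟨e, rfl⟩
  have hYL : ∀ e : M, y ^ (p - 1) • e ∈ L := fun e => Submodule.mem_sup_left ⟨e, rfl⟩
  have memL : ∀ w, w ∈ L ↔ ∃ d e : M, w = y ^ (p - 1) • d + x • e := by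
    intro w
    simp only [L, Submodule.mem_sup, LinearMap.mem_range]
    constructor
    · rintro ⟨_, ⟨d, rfl⟩, _, ⟨e, rfl⟩, rfl⟩
      exact ⟨d, e, rfl⟩
    · rintro ⟨d, e, rfl⟩
      exact ⟨_, ⟨d, rfl⟩, _, ⟨e, rfl⟩, rfl⟩
  have hSx : ∀ w b : M, y • w = x • b → y • w = x • S (y • w) := by
    intro w b hw
    have : x • S (x • b) = x • b := hS b
    rw [hw, this]
  have hQ : ∀ w b : M, y • w = x • b → y ^ (p - 1) • S (y • w) = x ^ (p - 1) • Q w := by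
    intro w b hw
    have h1 := hSx w b hw
    obtain ⟨d, hd⟩ := hx₁ (y ^ (p - 1) • S (y • w)) (by
      rw [smul_comm, ← h1, smul_smul, mul_comm, hyy, zero_smul])
    have : x ^ (p - 1) • T (x ^ (p - 1) • d) = x ^ (p - 1) • d := hT d
    change _ = x ^ (p - 1) • T (y ^ (p - 1) • S (y • w))
    rw [hd, this]
  have hQ' : ∀ w b : M, y • w = x • b → ∃ e, y ^ (p - 1) • b =
      x ^ (p - 1) • (Q w + y ^ (p - 1) • e) := by
    intro w b hw
    obtain ⟨e, he⟩ := hx₁ (b - S (y • w)) (by rw [smul_sub, ← hSx w b hw, hw, sub_self])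
    refine ⟨e, ?_⟩
    rw [smul_add, ← hQ w b hw, smul_comm (x ^ (p - 1)), ← he, ← smul_add, add_sub_cancel]
  have hQL : ∀ w b : M, y • w = x • b → y ^ (p - 1) • b = 0 → Q w ∈ L := by
    intro w b hw hb
    obtain ⟨e, he⟩ := hQ' w b hw
    obtain ⟨d, hd⟩ := hx₂ _ (he.symm.trans hb)
    rw [eq_sub_of_add_eq hd]
    exact L.sub_mem (hXL _) (hYL _)
  have hKL : K ≤ L := by
    by_contra hKL
    obtain ⟨w, ⟨b, hb⟩, hwL, c, hc⟩ := exists_eigenvector_mod Q K L (by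
      rintro w ⟨b, hb⟩
      obtain ⟨d, hd⟩ := hx₂ (y • Q w) (by
        rw [smul_comm, ← hQ w b hb.symm, smul_smul, hyy, zero_smul])
      exact ⟨d, hd.symm⟩) (by
      intro w hw
      obtain ⟨d, e, rfl⟩ := (memL w).1 hw
      refine hQL _ (y • e) ?_ ?_
      · rw [smul_add, smul_smul, hyy, zero_smul, zero_add, smul_comm]
      · rw [smul_smul, mul_comm, hyy, zero_smul]) hKL
    obtain ⟨μ, rfl⟩ := IsAlgClosed.exists_pow_nat_eq c (Fact.out : p.Prime).pos
    have hb' : y • w = x • b := hb.symm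
    obtain ⟨e, he⟩ := hQ' w b hb'
    obtain ⟨d, f, hdf⟩ := (memL _).1 hc
    have hxz : ∀ n, x ^ (p - 1) * (y - μ • x) ^ n = x ^ (p - 1) * y ^ n := by
      intro n
      induction n with
      | zero => simp
      | succ n ih =>
        rw [pow_succ, ← mul_assoc, ih, mul_sub, mul_smul_comm, mul_right_comm, mul_comm _ x,
          ← mul_assoc x, hxx]
        simp [pow_succ', mul_assoc]
    have h1 : (y - μ • x) ^ (p - 1) • (b - μ • w) =
        (y - μ • x) ^ (p - 1) • x ^ (p - 1) • (d + e) := by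
      have h2 := geom_sum_smul_sub_smul x y μ w b hb' (p - 1)
      rw [hp, ← sub_pow_pred_char_eq_geom_sum k p (μ • x) y, he] at h2
      rw [h2, smul_smul _ (x ^ (p - 1)), mul_comm _ (x ^ (p - 1)), hxz, mul_smul, smul_comm (μ ^ p),
        ← smul_sub, add_sub_right_comm, hdf, add_right_comm, smul_add, smul_smul _ x,
        mul_comm _ x, hxx, zero_smul, add_zero, smul_add (y ^ (p - 1))]
    obtain ⟨g, hg⟩ := hz₂ μ (b - μ • w - x ^ (p - 1) • (d + e)) (by rw [smul_sub, h1, sub_self])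
    obtain ⟨q, hq⟩ := hz₁ μ (w - x • g) (by
      rw [smul_sub, smul_comm _ x g, ← hg, smul_sub, smul_smul x, hxx, zero_smul, sub_zero,
        smul_sub, ← hb', sub_smul, smul_assoc, smul_comm x μ, sub_self])
    apply hwL
    rw [eq_add_of_sub_eq hq]
    refine L.add_mem ?_ (hXL _)
    have h3 : ∀ n, ∃ r, (y - μ • x) ^ n • q = y ^ n • q + x • r := by
      intro n
      obtain ⟨t, ht⟩ := sub_dvd_pow_sub_pow (y - μ • x) y n
      refine ⟨-(μ • t) • q, ?_⟩
      rw [smul_smul, ← add_smul]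
      congr 1
      rw [sub_eq_iff_eq_add'] at ht
      rw [ht]
      simp
    obtain ⟨r, hr⟩ := h3 (p - 1)
    rw [hr]
    exact L.add_mem (hYL _) (hXL _)
  exact (memL v).1 (hKL ⟨a, hva.symm⟩)

section FreenessCriterion
open Module

section
variable {k M : Type*} [Field k] [AddCommGroup M] [Module k M] [FiniteDimensional k M]

theorem LinearMap.finrank_ker_mul (g f : Module.End k M) :
    finrank k (LinearMap.ker (g * f)) =
      finrank k (LinearMap.ker f) + finrank k ↥(LinearMap.ker g ⊓ LinearMap.range f) := by
  have h := LinearMap.finrank_range_add_finrank_ker (f.domRestrict (LinearMap.ker (g * f)))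
  have h1 : LinearMap.range (f.domRestrict (LinearMap.ker (g * f))) =
      LinearMap.ker g ⊓ LinearMap.range f := by
    ext w
    simp only [LinearMap.mem_range, Submodule.mem_inf, LinearMap.mem_ker]
    constructor
    · rintro ⟨⟨v, hv⟩, rfl⟩
      exact ⟨hv, v, rfl⟩
    · rintro ⟨hw, v, rfl⟩
      exact ⟨⟨v, hw⟩, rfl⟩
  have h2 : finrank k (LinearMap.ker (f.domRestrict (LinearMap.ker (g * f)))) =
      finrank k (LinearMap.ker f) := by
    have h3 : (LinearMap.ker (f.domRestrict (LinearMap.ker (g * f)))).map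
        (LinearMap.ker (g * f)).subtype = LinearMap.ker f := by
      ext v
      simp only [Submodule.mem_map, LinearMap.mem_ker]
      constructor
      · rintro ⟨⟨v, hv⟩, h, rfl⟩
        exact h
      · intro hv
        exact ⟨⟨v, by simp [hv]⟩, hv, rfl⟩
    rw [← h3]
    exact (Submodule.finrank_map_subtype_eq _ _).symm
  rw [h1, h2] at h
  omega

theorem LinearMap.finrank_ker_pow_le (f : Module.End k M) (n : ℕ) :
    finrank k (LinearMap.ker (f ^ n)) ≤ n * finrank k (LinearMap.ker f) := by
  induction n with
  | zero => simp [Module.End.one_eq_id, LinearMap.ker_id]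
  | succ n ih =>
    rw [pow_succ', LinearMap.finrank_ker_mul, add_mul, one_mul]
    exact add_le_add ih (Submodule.finrank_mono inf_le_left)

theorem LinearMap.ker_eq_range_of_finrank_eq (f : Module.End k M) (n : ℕ) (hf : f ^ (n + 1) = 0)
    (h : finrank k M = (n + 1) * finrank k (LinearMap.ker f)) :
    LinearMap.ker f = LinearMap.range (f ^ n) ∧ LinearMap.ker (f ^ n) = LinearMap.range f := by
  have h1 := LinearMap.finrank_range_add_finrank_ker f
  have h2 := LinearMap.finrank_range_add_finrank_ker (f ^ n)
  have h3 := LinearMap.finrank_ker_pow_le f n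
  have h4 : LinearMap.range f ≤ LinearMap.ker (f ^ n) := by
    rintro _ ⟨v, rfl⟩
    rw [LinearMap.mem_ker, ← Module.End.mul_apply, ← pow_succ, hf, LinearMap.zero_apply]
  have h5 : LinearMap.range (f ^ n) ≤ LinearMap.ker f := by
    rintro _ ⟨v, rfl⟩
    rw [LinearMap.mem_ker, ← Module.End.mul_apply, ← pow_succ', hf, LinearMap.zero_apply]
  rw [add_mul, one_mul] at h
  have h6 := Submodule.finrank_mono h4
  have h7 := Submodule.finrank_mono h5
  exact ⟨(Submodule.eq_of_le_of_finrank_eq h5 (by omega)).symm,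
    (Submodule.eq_of_le_of_finrank_eq h4 (by omega)).symm⟩

theorem LinearMap.finrank_eq_of_ker_le_range (f : Module.End k M) (n : ℕ) (hf : f ^ (n + 1) = 0)
    (h : LinearMap.ker f ≤ LinearMap.range (f ^ n)) :
    finrank k M = (n + 1) * finrank k (LinearMap.ker f) := by
  have key : ∀ j ≤ n + 1, finrank k (LinearMap.ker (f ^ j)) = j * finrank k (LinearMap.ker f) := by
    intro j
    induction j with
    | zero => simp [Module.End.one_eq_id, LinearMap.ker_id]
    | succ j ih =>
      intro hj
      have h1 : LinearMap.ker f ≤ LinearMap.range (f ^ j) := by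
        refine h.trans ?_
        obtain ⟨i, rfl⟩ := Nat.exists_eq_add_of_le (Nat.le_of_succ_le_succ hj)
        rintro _ ⟨v, rfl⟩
        exact ⟨(f ^ i) v, by rw [pow_add]; rfl⟩
      rw [pow_succ', LinearMap.finrank_ker_mul, ih (by omega), inf_eq_left.2 h1, add_mul, one_mul]
  rw [← key _ le_rfl, hf, LinearMap.ker_zero, finrank_top]
end

section
variable {k A M : Type*} [Field k] [CommRing A] [Algebra k A] [AddCommGroup M]
  [Module k M] [Module A M] [IsScalarTower k A M]

theorem range_lsmul_eq_restrictScalars (x : A) : LinearMap.range (Algebra.lsmul k k M x) =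
    (Ideal.span {x} • (⊤ : Submodule A M)).restrictScalars k := by
  ext v
  simp [Submodule.ideal_span_singleton_smul,
    Submodule.mem_smul_pointwise_iff_exists]

theorem finrank_quotient_span_singleton [FiniteDimensional k M] (x : A) :
    finrank k (M ⧸ (Ideal.span {x} • (⊤ : Submodule A M))) =
    finrank k (LinearMap.ker (Algebra.lsmul k k M x)) := by
  have h1 := LinearMap.finrank_range_add_finrank_ker (Algebra.lsmul k k M x)
  have h2 := Submodule.finrank_quotient_add_finrank
    ((Ideal.span {x} • (⊤ : Submodule A M)).restrictScalars k)
  rw [range_lsmul_eq_restrictScalars] at h1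
  have h3 := (Submodule.Quotient.restrictScalarsEquiv k
    (Ideal.span {x} • (⊤ : Submodule A M))).finrank_eq
  omega

theorem finrank_quotient_quotient (I J : Ideal A) :
    finrank k ((M ⧸ (I • (⊤ : Submodule A M))) ⧸
      (J • (⊤ : Submodule A (M ⧸ (I • (⊤ : Submodule A M)))))) =
    finrank k (M ⧸ ((I ⊔ J) • (⊤ : Submodule A M))) := by
  have h : J • (⊤ : Submodule A (M ⧸ (I • (⊤ : Submodule A M)))) =
      ((I ⊔ J) • (⊤ : Submodule A M)).map (I • (⊤ : Submodule A M)).mkQ := by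
    rw [Submodule.sup_smul, Submodule.map_sup, Submodule.map_smul'' J, Submodule.map_top,
      Submodule.range_mkQ, Submodule.mkQ_map_self, bot_sup_eq]
  rw [h]
  exact ((Submodule.quotientQuotientEquivQuotient _ _
    (Submodule.smul_mono_left le_sup_left)).restrictScalars k).finrank_eq

theorem finrank_quotient_bot_smul :
    finrank k (M ⧸ ((⊥ : Ideal A) • (⊤ : Submodule A M))) = finrank k M := by
  rw [Submodule.bot_smul]
  exact ((Submodule.quotEquivOfEqBot (⊥ : Submodule A M) rfl).restrictScalars k).finrank_eq

end

section
variable {k A : Type*} [Field k] [CommRing A] [Algebra k A]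

theorem finrank_le_pow_mul_finrank_quotient {p r : ℕ} (u : Fin r → A)
    (hu : ∀ i, u i ^ p = 0) (M : Type*) [AddCommGroup M] [Module k M] [Module A M]
    [IsScalarTower k A M] [FiniteDimensional k M] :
    finrank k M ≤ p ^ r * finrank k (M ⧸ (Ideal.span (Set.range u) • (⊤ : Submodule A M))) := by
  induction r generalizing M with
  | zero =>
    rw [Set.range_eq_empty, Ideal.span_empty, finrank_quotient_bot_smul, pow_zero, one_mul]
  | succ r ih =>
    have h1 := ih (Fin.tail u) (fun i => hu i.succ)
      (M ⧸ (Ideal.span {u 0} • (⊤ : Submodule A M)))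
    rw [finrank_quotient_quotient, ← Ideal.span_insert, ← Set.singleton_union,
      finrank_quotient_span_singleton] at h1
    rw [Fin.range_fin_succ, ← Set.singleton_union, pow_succ', mul_assoc]
    refine le_trans ?_ (Nat.mul_le_mul_left p h1)
    have h2 := LinearMap.finrank_ker_pow_le (Algebra.lsmul k k M (u 0)) p
    rwa [← map_pow, hu, map_zero, LinearMap.ker_zero, finrank_top] at h2

theorem finrank_quotient_eq_mul_finrank_quotient_pair [IsAlgClosed k] (p : ℕ) [Fact p.Prime]
    [CharP k p] (x y : A) (hxp : x ^ p = 0) (hyp : y ^ p = 0) (M : Type*) [AddCommGroup M]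
    [Module k M] [Module A M] [IsScalarTower k A M] [FiniteDimensional k M]
    (hx : finrank k M = p * finrank k (M ⧸ (Ideal.span {x} • (⊤ : Submodule A M))))
    (hz : ∀ c : k, finrank k M =
      p * finrank k (M ⧸ (Ideal.span {y - c • x} • (⊤ : Submodule A M)))) :
    finrank k (M ⧸ (Ideal.span {x} • (⊤ : Submodule A M))) =
      p * finrank k (M ⧸ ((Ideal.span {x} ⊔ Ideal.span {y}) • (⊤ : Submodule A M))) := by
  have hp : p - 1 + 1 = p := Nat.sub_add_cancel (Fact.out : p.Prime).one_le
  have key : ∀ z : A, z ^ p = 0 →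
      finrank k M = p * finrank k (M ⧸ (Ideal.span {z} • (⊤ : Submodule A M))) →
      (∀ m : M, z • m = 0 → ∃ d : M, m = z ^ (p - 1) • d) ∧
      (∀ m : M, z ^ (p - 1) • m = 0 → ∃ d : M, m = z • d) := by
    intro z hzp h
    rw [finrank_quotient_span_singleton] at h
    obtain ⟨h1, h2⟩ := LinearMap.ker_eq_range_of_finrank_eq (Algebra.lsmul k k M z) (p - 1)
      (by rw [hp, ← map_pow, hzp, map_zero]) (by rw [hp, h])
    rw [← map_pow] at h1 h2
    constructor
    · intro m hm
      obtain ⟨d, hd⟩ := h1.le hm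
      exact ⟨d, hd.symm⟩
    · intro m hm
      obtain ⟨d, hd⟩ := h2.le hm
      exact ⟨d, hd.symm⟩
  have hzp : ∀ c : k, (y - c • x) ^ p = 0 := by
    intro c
    nontriviality A
    have := charP_of_injective_algebraMap (algebraMap k A).injective p
    rw [sub_pow_char, smul_pow, hxp, hyp, smul_zero, sub_zero]
  rw [← finrank_quotient_quotient, finrank_quotient_span_singleton (M := M ⧸ _) y]
  have h := LinearMap.finrank_eq_of_ker_le_range
    (Algebra.lsmul k k (M ⧸ (Ideal.span {x} • (⊤ : Submodule A M))) y) (p - 1)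
    (by rw [hp, ← map_pow, hyp, map_zero]) ?_
  · rwa [hp] at h
  rintro w hw
  obtain ⟨v, rfl⟩ := Submodule.Quotient.mk_surjective _ w
  have hmem : ∀ m : M, m ∈ (Ideal.span {x} • (⊤ : Submodule A M)) ↔ ∃ a, x • a = m := by
    intro m
    rw [← Submodule.restrictScalars_mem k, ← range_lsmul_eq_restrictScalars]
    rfl
  obtain ⟨a, ha⟩ : ∃ a, x • a = y • v := by
    rw [← hmem, ← Submodule.Quotient.mk_eq_zero, Submodule.Quotient.mk_smul]
    exact hw
  obtain ⟨d, e, hde⟩ := mem_range_pow_sup_of_smul_mem p x y hxp hyp (key x hxp hx).1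
    (key x hxp hx).2 (fun c => (key _ (hzp c) (hz c)).1) (fun c => (key _ (hzp c) (hz c)).2) v a
    ha.symm
  refine ⟨Submodule.Quotient.mk d, ?_⟩
  rw [← map_pow]
  change Submodule.Quotient.mk (y ^ (p - 1) • d) = _
  rw [eq_comm, Submodule.Quotient.eq, hmem]
  exact ⟨e, by rw [hde, add_sub_cancel_left]⟩

theorem finrank_eq_pow_mul_finrank_quotient [IsAlgClosed k] (p : ℕ) [Fact p.Prime]
    [CharP k p] {r : ℕ} (u : Fin r → A) (hu : ∀ c : Fin r → k, (∑ i, c i • u i) ^ p = 0)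
    (M : Type*) [AddCommGroup M]
    [Module k M] [Module A M] [IsScalarTower k A M] [FiniteDimensional k M]
    (h : ∀ c : Fin r → k, c ≠ 0 → finrank k M =
      p * finrank k (M ⧸ (Ideal.span {∑ i, c i • u i} • (⊤ : Submodule A M)))) :
    finrank k M = p ^ r * finrank k (M ⧸ (Ideal.span (Set.range u) • (⊤ : Submodule A M))) := by
  induction r generalizing M with
  | zero =>
    rw [Set.range_eq_empty, Ideal.span_empty, finrank_quotient_bot_smul, pow_zero, one_mul]
  | succ r ih =>
    have hcons : ∀ (a : k) (c : Fin r → k), ∑ i, (Fin.cons a c : Fin (r + 1) → k) i • u i =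
        a • u 0 + ∑ i, c i • Fin.tail u i := by
      intro a c
      simp [Fin.sum_univ_succ, Fin.tail]
    have h0 : ∑ i, (Fin.cons 1 0 : Fin (r + 1) → k) i • u i = u 0 := by
      simp [hcons]
    have h1 : ∀ c, ∑ i, (Fin.cons 0 c : Fin (r + 1) → k) i • u i = ∑ i, c i • Fin.tail u i := by
      simp [hcons]
    have hM := h (Fin.cons 1 0) (fun h => one_ne_zero (congrFun h 0))
    rw [h0] at hM
    have h2 := ih (Fin.tail u) (fun c => by rw [← h1, hu])
      (M ⧸ (Ideal.span {u 0} • (⊤ : Submodule A M))) (by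
        intro c hc
        rw [finrank_quotient_quotient]
        refine finrank_quotient_eq_mul_finrank_quotient_pair p (u 0) _ (by rw [← h0, hu])
          (by rw [← h1, hu]) M hM ?_
        intro a
        have := h (Fin.cons (-a) c) (fun h => hc (funext fun i => congrFun h i.succ))
        rwa [hcons, neg_smul, neg_add_eq_sub] at this)
    rw [hM, h2, finrank_quotient_quotient, ← Ideal.span_union, Set.singleton_union,
      Fin.range_fin_succ, pow_succ', mul_assoc]
end

section
variable (k : Type*) [Field k] (r p : ℕ)

theorem mem_truncIdeal_iff (f : MvPolynomial (Fin r) k) :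
    f ∈ truncIdeal k r p ↔ ∀ e ∈ f.support, ∃ i, p ≤ e i := by
  have h : truncIdeal k r p = Ideal.span ((fun s => MvPolynomial.monomial s (1 : k)) ''
      Set.range fun i : Fin r => Finsupp.single i p) := by
    rw [truncIdeal, ← Set.range_comp]
    congr 2
    ext1 i
    simp [MvPolynomial.X_pow_eq_monomial]
  rw [h, MvPolynomial.mem_ideal_span_monomial_image]
  simp [Finsupp.single_le_iff]

def boxCoeff : MvPolynomial (Fin r) k →ₗ[k] ((Fin r → Fin p) → k) :=
  LinearMap.pi fun e => MvPolynomial.lcoeff k (Finsupp.equivFunOnFinite.symm fun i => (e i : ℕ))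

theorem boxCoeff_surjective : Function.Surjective (boxCoeff k r p) := by
  intro g
  refine ⟨∑ e, MvPolynomial.monomial (Finsupp.equivFunOnFinite.symm fun i => (e i : ℕ)) (g e), ?_⟩
  ext e
  have h : ∀ e' : Fin r → Fin p, (Finsupp.equivFunOnFinite.symm fun i => (e' i : ℕ)) =
      (Finsupp.equivFunOnFinite.symm fun i => (e i : ℕ)) ↔ e' = e := by
    intro e'
    rw [Equiv.apply_eq_iff_eq, funext_iff, funext_iff]
    simp [Fin.ext_iff]
  simp [boxCoeff, MvPolynomial.coeff_monomial, h]

theorem ker_boxCoeff :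
    LinearMap.ker (boxCoeff k r p) = (truncIdeal k r p).restrictScalars k := by
  ext f
  rw [Submodule.restrictScalars_mem, mem_truncIdeal_iff, LinearMap.mem_ker]
  constructor
  · intro hf e he
    by_contra! h
    have h0 : MvPolynomial.coeff (Finsupp.equivFunOnFinite.symm e) f = 0 :=
      congrFun hf fun i => ⟨e i, h i⟩
    rw [Finsupp.equivFunOnFinite_symm_coe] at h0
    exact MvPolynomial.mem_support_iff.1 he h0
  · intro hf
    ext e
    by_contra h
    obtain ⟨i, hi⟩ := hf _ (MvPolynomial.mem_support_iff.2 h)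
    exact absurd hi (by simp)

def truncAlgEquivBox : TruncAlg k r p ≃ₗ[k] ((Fin r → Fin p) → k) :=
  (Submodule.Quotient.restrictScalarsEquiv k (truncIdeal k r p)).symm ≪≫ₗ
    Submodule.quotEquivOfEq _ _ (ker_boxCoeff k r p).symm ≪≫ₗ
    (boxCoeff k r p).quotKerEquivOfSurjective (boxCoeff_surjective k r p)

theorem finrank_truncAlg : finrank k (TruncAlg k r p) = p ^ r := by
  rw [(truncAlgEquivBox k r p).finrank_eq]
  simp

instance finiteDimensional_truncAlg : FiniteDimensional k (TruncAlg k r p) :=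
  Module.Finite.equiv (truncAlgEquivBox k r p).symm

variable {k r p}

theorem exists_algHom_xGen_eq {A : Type*} [CommRing A] [Algebra k A] (v : Fin r → A)
    (hv : ∀ i, v i ^ p = 0) : ∃ φ : TruncAlg k r p →ₐ[k] A, ∀ i, φ (xGen k r p i) = v i := by
  refine ⟨Ideal.Quotient.liftₐ _ (MvPolynomial.aeval v) ?_, fun i => ?_⟩
  · intro a ha
    rw [← RingHom.mem_ker]
    refine (Ideal.span_le.2 ?_ : truncIdeal k r p ≤ _) ha
    rintro _ ⟨i, rfl⟩
    simp [RingHom.mem_ker, hv]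
  · exact MvPolynomial.aeval_X v i

theorem algHom_ext_xGen {A : Type*} [CommRing A] [Algebra k A] {φ ψ : TruncAlg k r p →ₐ[k] A}
    (h : ∀ i, φ (xGen k r p i) = ψ (xGen k r p i)) : φ = ψ := by
  apply Ideal.Quotient.algHom_ext
  ext i
  exact h i

variable (k r p)
theorem xGen_pow (i : Fin r) : xGen k r p i ^ p = 0 := by
  rw [xGen, ← map_pow, Ideal.Quotient.eq_zero_iff_mem]
  exact Ideal.subset_span ⟨i, rfl⟩

theorem exists_augmentation (hp : p ≠ 0) : ∃ ε : TruncAlg k r p →ₐ[k] k, ∀ c,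
    ε c = 0 ↔ c ∈ radIdeal k r p := by
  obtain ⟨ε, hε⟩ := exists_algHom_xGen_eq (k := k) (r := r) (p := p) (fun _ => (0 : k))
    (fun _ => zero_pow hp)
  have h1 : Ideal.Quotient.mkₐ k (radIdeal k r p) =
      (Algebra.ofId k (TruncAlg k r p ⧸ radIdeal k r p)).comp ε := by
    refine algHom_ext_xGen (A := TruncAlg k r p ⧸ radIdeal k r p) fun i => ?_
    rw [AlgHom.comp_apply, hε, map_zero, Ideal.Quotient.mkₐ_eq_mk, Ideal.Quotient.eq_zero_iff_mem]
    exact Ideal.subset_span ⟨i, rfl⟩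
  refine ⟨ε, fun c => ⟨fun hc => ?_, fun hc => ?_⟩⟩
  · have := DFunLike.congr_fun h1 c
    rwa [AlgHom.comp_apply, hc, map_zero, Ideal.Quotient.mkₐ_eq_mk,
      Ideal.Quotient.eq_zero_iff_mem] at this
  · rw [← RingHom.mem_ker]
    refine (Ideal.span_le.2 ?_ : radIdeal k r p ≤ _) hc
    rintro _ ⟨i, rfl⟩
    exact hε i

theorem finrank_quotient_radIdeal (hp : p ≠ 0) :
    finrank k (TruncAlg k r p ⧸ radIdeal k r p) = 1 := by
  obtain ⟨ε, hε⟩ := exists_augmentation k r p hp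
  have h : radIdeal k r p = RingHom.ker ε := by
    ext c
    rw [RingHom.mem_ker, hε]
  have hs : Function.Surjective ε := fun a => ⟨algebraMap _ _ a, by simp⟩
  rw [((Ideal.quotientEquivAlgOfEq k h).trans
    (Ideal.quotientKerAlgEquivOfSurjective hs)).toLinearEquiv.finrank_eq, finrank_self]

variable {k r p} in
theorem pow_eq_zero_of_mem_radIdeal [Fact p.Prime] [CharP k p] {a : TruncAlg k r p}
    (ha : a ∈ radIdeal k r p) : a ^ p = 0 := by
  have hp0 := (Fact.out : p.Prime).ne_zero
  obtain ⟨ε, -⟩ := exists_augmentation k r p hp0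
  have : Nontrivial (TruncAlg k r p) := ε.toRingHom.domain_nontrivial
  have := charP_of_injective_algebraMap (algebraMap k (TruncAlg k r p)).injective p
  induction ha using Submodule.span_induction with
  | mem x hx =>
    obtain ⟨i, rfl⟩ := hx
    exact xGen_pow k r p i
  | zero => exact zero_pow hp0
  | add x y _ _ hx hy => rw [add_pow_char, hx, hy, add_zero]
  | smul c x _ hx => rw [smul_eq_mul, mul_pow, hx, mul_zero]

theorem radIdeal_le_jacobson [Fact p.Prime] [CharP k p] :
    radIdeal k r p ≤ (⊥ : Ideal (TruncAlg k r p)).jacobson := fun _ ha =>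
  Ideal.radical_le_jacobson ⟨p, pow_eq_zero_of_mem_radIdeal ha⟩

theorem free_iff_finrank_eq [Fact p.Prime] [CharP k p] (M : Type*) [AddCommGroup M] [Module k M]
    [Module (TruncAlg k r p) M] [IsScalarTower k (TruncAlg k r p) M] [FiniteDimensional k M] :
    Module.Free (TruncAlg k r p) M ↔ finrank k M =
      p ^ r * finrank k (M ⧸ (radIdeal k r p • (⊤ : Submodule (TruncAlg k r p) M))) := by
  have hp0 := (Fact.out : p.Prime).ne_zero
  have hfin : Module.Finite (TruncAlg k r p) M := Module.Finite.of_restrictScalars_finite k _ _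
  obtain ⟨ε, hε⟩ := exists_augmentation k r p hp0
  constructor
  · intro hfree
    have : Nontrivial (TruncAlg k r p) := ε.toRingHom.domain_nontrivial
    have h1 := finrank_quotient_radIdeal k r p hp0
    have : Nontrivial (TruncAlg k r p ⧸ radIdeal k r p) :=
      Module.nontrivial_of_finrank_pos (R := k) (by omega)
    have h2 := ((TensorProduct.quotTensorEquivQuotSMul M (radIdeal k r p)).restrictScalars
      k).finrank_eq
    have h3 := Module.finrank_baseChange (R := TruncAlg k r p ⧸ radIdeal k r p)
      (S := TruncAlg k r p) (M' := M)
    have h4 := Module.finrank_mul_finrank k (TruncAlg k r p ⧸ radIdeal k r p)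
      ((TruncAlg k r p ⧸ radIdeal k r p) ⊗[TruncAlg k r p] M)
    rw [← h2, ← h4, h1, h3, one_mul, ← finrank_truncAlg k r p, Module.finrank_mul_finrank]
  · intro h
    let N := M ⧸ (radIdeal k r p • (⊤ : Submodule (TruncAlg k r p) M))
    let b := Module.finBasis k N
    choose m hm using fun i => Submodule.Quotient.mk_surjective _ (b i)
    let f : (Fin (finrank k N) → TruncAlg k r p) →ₗ[TruncAlg k r p] M :=
      Fintype.linearCombination (TruncAlg k r p) m
    have hsurj : Function.Surjective f := by
      apply LinearMap.surjective_of_surjective_comp_mkQ f _ (radIdeal_le_jacobson k r p)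
      intro w
      refine ⟨fun i => algebraMap k _ (b.repr w i), ?_⟩
      simp only [LinearMap.comp_apply, f, Fintype.linearCombination_apply, map_sum, algebraMap_smul,
        Submodule.mkQ_apply, Submodule.Quotient.mk_smul, hm]
      exact b.sum_repr w
    have hinj : Function.Injective f := by
      refine (LinearMap.injective_iff_surjective_of_finrank_eq_finrank
        (f := f.restrictScalars k) ?_).2 hsurj
      rw [h, Module.finrank_pi_fintype]
      simp [finrank_truncAlg, mul_comm, N]
    exact Module.Free.of_equiv (LinearEquiv.ofBijective f ⟨hinj, hsurj⟩)

variable {k r p} in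
theorem isFreeVia_iff [Fact p.Prime] [CharP k p] {A : Type*} [CommRing A] [Algebra k A]
    (M : Type*) [AddCommGroup M] [Module k M]
    [Module A M] [IsScalarTower k A M] [FiniteDimensional k M] (α : TruncAlg k r p →ₐ[k] A)
    (u : Fin r → A) (hα : ∀ i, α (xGen k r p i) = u i) :
    IsFreeVia α.toRingHom M ↔ finrank k M =
      p ^ r * finrank k (M ⧸ (Ideal.span (Set.range u) • (⊤ : Submodule A M))) := by
  let _ : Module (TruncAlg k r p) M := Module.compHom M α.toRingHom
  let _ : Algebra (TruncAlg k r p) A := α.toRingHom.toAlgebra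
  have : IsScalarTower (TruncAlg k r p) A M := ⟨fun c a m => by
    rw [Algebra.smul_def, mul_smul]; rfl⟩
  have : IsScalarTower k (TruncAlg k r p) M := ⟨fun c a m => by
    change α (c • a) • m = c • α a • m
    rw [map_smul, smul_assoc]⟩
  have h : (radIdeal k r p).map (algebraMap (TruncAlg k r p) A) = Ideal.span (Set.range u) := by
    rw [radIdeal, Ideal.map_span, ← Set.range_comp]
    congr 2
    ext1 i
    exact hα i
  have h2 := Ideal.smul_restrictScalars (radIdeal k r p) (⊤ : Submodule A M)
  rw [h] at h2
  have h3 : finrank k (M ⧸ (radIdeal k r p • (⊤ : Submodule (TruncAlg k r p) M))) =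
      finrank k (M ⧸ (Ideal.span (Set.range u) • (⊤ : Submodule A M))) := by
    rw [← Submodule.restrictScalars_top (TruncAlg k r p) A M, ← h2]
    exact ((Submodule.Quotient.restrictScalarsEquiv (TruncAlg k r p) _).restrictScalars
      k).finrank_eq
  rw [← h3]
  exact free_iff_finrank_eq k r p M
end

end FreenessCriterion

theorem span_sum_smul_sup_span_succAbove {k A : Type*} [Field k] [CommRing A] [Algebra k A]
    {r : ℕ} (u : Fin (r + 1) → A) (c : Fin (r + 1) → k) (j : Fin (r + 1)) (hj : c j ≠ 0) :
    Ideal.span {∑ i, c i • u i} ⊔ Ideal.span (Set.range fun i => u (j.succAbove i)) =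
      Ideal.span (Set.range u) := by
  have hsmul : ∀ (I : Ideal A) (a : k) (x : A), x ∈ I → a • x ∈ I := fun I a x hx => by
    rw [Algebra.smul_def]
    exact I.mul_mem_left _ hx
  apply le_antisymm
  · refine sup_le ?_ (Ideal.span_mono ?_)
    · rw [Ideal.span_singleton_le_iff_mem]
      exact Submodule.sum_mem _ fun i _ => hsmul _ _ _ (Ideal.subset_span ⟨i, rfl⟩)
    · rintro _ ⟨i, rfl⟩
      exact ⟨_, rfl⟩
  · have h : ∀ i, u (j.succAbove i) ∈
        Ideal.span {∑ i, c i • u i} ⊔ Ideal.span (Set.range fun i => u (j.succAbove i)) :=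
      fun i => Ideal.mem_sup_right (Ideal.subset_span ⟨i, rfl⟩)
    rw [Ideal.span_le]
    rintro _ ⟨i, rfl⟩
    refine Fin.succAboveCases j ?_ h i
    have h1 : u j = (c j)⁻¹ • (∑ i, c i • u i - ∑ i, c (j.succAbove i) • u (j.succAbove i)) := by
      rw [Fin.sum_univ_succAbove _ j, add_sub_cancel_right, inv_smul_smul₀ hj]
    rw [SetLike.mem_coe, h1]
    exact hsmul _ _ _ (Ideal.sub_mem _ (Ideal.mem_sup_left (Ideal.mem_span_singleton_self _))
      (Submodule.sum_mem _ fun i _ => hsmul _ _ _ (h i)))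

/-- For a finite-dimensional `A`-module `M` and an `r`-dimensional subspace `U ⊆ V`
(presented by a basis `u₁,…,u_r`), the restriction `α_U^*(M)` is free as a
`C = k[t₁,…,t_r]/(tᵢᵖ)`-module if and only if for every nonzero `u ∈ U`, `M` is free as a
`k[t]/(tᵖ)`-module with `t` acting by multiplication by `u`. -/
theorem statement1 {k : Type*} [Field k] [IsAlgClosed k] (p n r : ℕ) [Fact p.Prime]
    [CharP k p]
    (V : Submodule k (TruncAlg k n p))
    (hV1 : V ⊓ Submodule.restrictScalars k ((radIdeal k n p) ^ 2 : Ideal (TruncAlg k n p)) = ⊥)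
    (hV2 : V ⊔ Submodule.restrictScalars k ((radIdeal k n p) ^ 2 : Ideal (TruncAlg k n p)) =
      Submodule.restrictScalars k (radIdeal k n p))
    (M : Type*) [AddCommGroup M] [Module k M] [Module (TruncAlg k n p) M]
    [IsScalarTower k (TruncAlg k n p) M] [FiniteDimensional k M]
    (u : Fin r → TruncAlg k n p) (hu : ∀ i, u i ∈ V) (hind : LinearIndependent k u) :
    (∀ α : TruncAlg k r p →ₐ[k] TruncAlg k n p,
        (∀ i, α (xGen k r p i) = u i) → IsFreeVia α.toRingHom M) ↔
      (∀ a : TruncAlg k n p, a ∈ Submodule.span k (Set.range u) → a ≠ 0 →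
        ∀ β : TruncAlg k 1 p →ₐ[k] TruncAlg k n p,
          β (xGen k 1 p 0) = a → IsFreeVia β.toRingHom M) := by
  have hrad : ∀ a ∈ Submodule.span k (Set.range u), a ∈ radIdeal k n p := by
    have hV : V ≤ (radIdeal k n p).restrictScalars k := hV2 ▸ le_sup_left
    exact fun a ha => (Submodule.span_le.2 (by rintro _ ⟨i, rfl⟩; exact hV (hu i)) :
      Submodule.span k (Set.range u) ≤ (radIdeal k n p).restrictScalars k) ha
  have hpow : ∀ a ∈ Submodule.span k (Set.range u), a ^ p = 0 := fun a ha =>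
    pow_eq_zero_of_mem_radIdeal (hrad a ha)
  have hupow : ∀ i, u i ^ p = 0 := fun i => hpow _ (Submodule.subset_span ⟨i, rfl⟩)
  have hsum : ∀ c : Fin r → k, ∑ i, c i • u i ∈ Submodule.span k (Set.range u) := fun c =>
    Submodule.sum_mem _ fun i _ => Submodule.smul_mem _ _ (Submodule.subset_span ⟨i, rfl⟩)
  constructor
  · intro h a ha ha0 β hβ
    obtain ⟨α, hα⟩ := exists_algHom_xGen_eq (k := k) u hupow
    have hM := (isFreeVia_iff M α u hα).1 (h α hα)
    rw [isFreeVia_iff M β (fun _ => a) (fun i => by rw [Fin.fin_one_eq_zero i, hβ]), pow_one,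
      Set.range_const]
    obtain ⟨c, rfl⟩ := (Submodule.mem_span_range_iff_exists_fun k).1 ha
    obtain ⟨j, hj⟩ : ∃ j, c j ≠ 0 := by
      by_contra! hc
      exact ha0 (by simp [hc])
    obtain ⟨r, rfl⟩ : ∃ s, r = s + 1 := Nat.exists_eq_succ_of_ne_zero j.pos.ne'
    apply le_antisymm
    · have h1 := finrank_le_pow_mul_finrank_quotient (k := k) (r := 1)
        (fun _ => ∑ i, c i • u i) (fun _ => hpow _ ha) M
      rwa [pow_one, Set.range_const] at h1
    · have h1 := finrank_le_pow_mul_finrank_quotient (k := k) (fun i => u (j.succAbove i))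
        (fun i => hupow _)
        (M ⧸ (Ideal.span {∑ i, c i • u i} • (⊤ : Submodule (TruncAlg k n p) M)))
      have h2 : Ideal.span {∑ i, c i • u i} ⊔ Ideal.span (Set.range fun i => u (j.succAbove i)) =
          Ideal.span (Set.range u) :=
        span_sum_smul_sup_span_succAbove u c j hj
      rw [finrank_quotient_quotient, h2] at h1
      rw [hM, pow_succ', mul_assoc]
      exact Nat.mul_le_mul_left p h1
  · intro h α hα
    rw [isFreeVia_iff M α u hα]
    refine finrank_eq_pow_mul_finrank_quotient p u (fun c => hpow _ (hsum c)) M fun c hc => ?_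
    obtain ⟨β, hβ⟩ := exists_algHom_xGen_eq (k := k) (r := 1) (fun _ => ∑ i, c i • u i)
      (fun _ => hpow _ (hsum c))
    have h0 : ∑ i, c i • u i ≠ 0 := fun h0 =>
      hc (funext fun i => Fintype.linearIndependent_iff.1 hind c h0 i)
    have h1 := (isFreeVia_iff M β _ hβ).1 (h _ (hsum c) h0 β (hβ 0))
    rwa [pow_one, Set.range_const] at h1

end
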